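/- Let 0<Δ<1, let y ∈ C²(cl(B₁); ℝ³) and let 0<a<b<1. Define Φ_{a,b}(x) = log(b/a) if |x|≤a, Φ_{a,b}(x) = log(b/|x|) if a<|x|≤b, and Φ_{a,b}(x) = 0 otherwise. Then | ∫_{B₁} (Σ_{i=1}^{3} det D²y_i) Φ_{a,b} dL² − πΔ² log(b/a) | ≤ ∫_{B_b∖B_a} |g_y − g_Δ|(x)/|x|² dL²(x) + (1/(2b)) ∫_{∂B_b} |g_y − g_Δ| dH¹ + (1/(2a)) ∫_{∂B_a} |g_y − g_Δ| dH¹. -/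

import Mathlib

open MeasureTheory Metric Real Filter Matrix
open scoped ENNReal Topology

noncomputable section

/-- The plane `ℝ²` with the Euclidean norm. -/
abbrev E2 : Type := EuclideanSpace ℝ (Fin 2)
/-- The space `ℝ³` with the Euclidean norm. -/
abbrev E3 : Type := EuclideanSpace ℝ (Fin 3)

/-- The `i`-th standard basis vector of `ℝ²`. -/
def e2 (i : Fin 2) : E2 := EuclideanSpace.single i 1

/-- Partial derivative in the direction of the `i`-th coordinate. -/
def pd (i : Fin 2) (f : E2 → ℝ) (x : E2) : ℝ := fderiv ℝ f x (e2 i)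

/-- Hessian matrix of a scalar function on `ℝ²`. -/
def hess (f : E2 → ℝ) (x : E2) : Matrix (Fin 2) (Fin 2) ℝ :=
  Matrix.of fun i j => pd i (pd j f) x

/-- Derivative matrix `Dy ∈ ℝ^{3×2}` of a map `y : ℝ² → ℝ³`. -/
def Dmat (y : E2 → E3) (x : E2) : Matrix (Fin 3) (Fin 2) ℝ :=
  Matrix.of fun i j => pd j (fun z => y z i) x

/-- Induced metric `g_y = (Dy)ᵀ Dy`. -/
def gmet (y : E2 → E3) (x : E2) : Matrix (Fin 2) (Fin 2) ℝ :=
  (Dmat y x)ᵀ * Dmat y x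

/-- The rotated vector `x⊥ = (-x₂, x₁)`. -/
def perpVec (x : E2) : Fin 2 → ℝ := ![-(x 1), x 0]

/-- The unit tangent `x̂⊥ = (-x₂, x₁)/|x|`. -/
def xperpUnit (x : E2) : Fin 2 → ℝ := fun i => perpVec x i / ‖x‖

/-- The reference (cone) metric `g_Δ = Id - Δ² x̂⊥ ⊗ x̂⊥`. -/
def gDelta (Δ : ℝ) (x : E2) : Matrix (Fin 2) (Fin 2) ℝ :=
  1 - Matrix.of fun i j => (Δ ^ 2 / ‖x‖ ^ 2) * perpVec x i * perpVec x j

/-- Squared Frobenius norm of a matrix. -/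
def frob2 {m n : Type*} [Fintype m] [Fintype n] (A : Matrix m n ℝ) : ℝ :=
  ∑ i, ∑ j, (A i j) ^ 2

/-- `|D²y|²`: the sum of the squared Frobenius norms of the Hessians of the components. -/
def hessNormSq (y : E2 → E3) (x : E2) : ℝ :=
  ∑ i : Fin 3, frob2 (hess (fun z => y z i) x)

/-- The free elastic energy `I_{h,Δ}(y)`. -/
def energy (h Δ : ℝ) (y : E2 → E3) : ℝ :=
  ∫ x in ball (0 : E2) 1, (frob2 (gmet y x - gDelta Δ x) + h ^ 2 * hessNormSq y x)

/-- The singular cone `y^Δ(x) = √(1-Δ²)·(x,0) + Δ|x| e₃`. -/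
def coneMap (Δ : ℝ) (x : E2) : E3 :=
  (WithLp.equiv 2 (Fin 3 → ℝ)).symm
    ![Real.sqrt (1 - Δ ^ 2) * x 0, Real.sqrt (1 - Δ ^ 2) * x 1, Δ * ‖x‖]


/-- The test function `Φ_{a,b}`. -/
def PhiTest (a b : ℝ) (x : E2) : ℝ :=
  if ‖x‖ ≤ a then Real.log (b / a)
  else if ‖x‖ ≤ b then Real.log (b / ‖x‖)
  else 0

theorem hadamard_slope {P Pr : ℝ → ℝ → ℝ} (hPr : Continuous (Function.uncurry Pr))
    (hP : ∀ r t, HasDerivAt (fun r => P r t) (Pr r t) r) (r h t : ℝ) :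
    P (r + h) t - P r t = h * ∫ s in (0:ℝ)..1, Pr (r + s * h) t := by
  have h1 : ∀ s ∈ Set.uIcc (0:ℝ) 1, HasDerivAt (fun s => P (r + s * h) t) (Pr (r + s * h) t * h) s := by
    intro s _
    have := (hP (r + s * h) t).comp s (((hasDerivAt_id s).mul_const h).const_add r)
    simpa [Function.comp_def] using this
  have hc : Continuous fun s : ℝ => Pr (r + s * h) t :=
    hPr.comp (f := fun s : ℝ => (r + s * h, t)) (by fun_prop)
  have := intervalIntegral.integral_eq_sub_of_hasDerivAt h1
    (Continuous.intervalIntegrable (by fun_prop) _ _)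
  rw [intervalIntegral.integral_mul_const] at this
  simp at this
  linarith

theorem slope_cont {Pr : ℝ → ℝ → ℝ} (hPr : Continuous (Function.uncurry Pr)) (r : ℝ) :
    Continuous (Function.uncurry fun h t : ℝ => ∫ s in (0:ℝ)..1, Pr (r + s * h) t) := by
  have : Continuous (Function.uncurry fun (p : ℝ × ℝ) (s : ℝ) => Pr (r + s * p.1) p.2) :=
    hPr.comp (f := fun q : (ℝ × ℝ) × ℝ => (r + q.2 * q.1.1, q.1.2)) (by fun_prop)
  exact intervalIntegral.continuous_parametric_intervalIntegral_of_continuous' this 0 1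

theorem hasDerivAt_of_eq_mul {S K : ℝ → ℝ} {r : ℝ} (hK : Continuous K)
    (h : ∀ h, S (r + h) - S r = h * K h) : HasDerivAt S (K 0) r := by
  rw [hasDerivAt_iff_tendsto_slope_zero]
  refine (hK.tendsto 0).mono_left nhdsWithin_le_nhds |>.congr' ?_
  filter_upwards [self_mem_nhdsWithin] with t ht
  rw [h t, smul_eq_mul, inv_mul_cancel_left₀ ht]

theorem hasDerivAt_paramInt {P Pr : ℝ → ℝ → ℝ} (hPr : Continuous (Function.uncurry Pr))
    (hPc : Continuous (Function.uncurry P))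
    (hP : ∀ r t, HasDerivAt (fun r => P r t) (Pr r t) r) (r α β : ℝ) :
    HasDerivAt (fun r => ∫ t in α..β, P r t) (∫ t in α..β, Pr r t) r := by
  have hK := intervalIntegral.continuous_parametric_intervalIntegral_of_continuous' (μ := volume)
    (slope_cont hPr r) α β
  have := hasDerivAt_of_eq_mul (S := fun r => ∫ t in α..β, P r t) (r := r) hK (by
    intro h
    have c : ∀ r, Continuous (P r) := fun r => hPc.comp (f := fun t => (r, t)) (by fun_prop)
    rw [← intervalIntegral.integral_sub ((c _).intervalIntegrable _ _) ((c _).intervalIntegrable _ _),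
      ← intervalIntegral.integral_const_mul]
    congr 1; ext t
    exact hadamard_slope hPr hP r h t)
  simpa using this

theorem hasDerivAt_area {P Q Pr Pt Qr Qt : ℝ → ℝ → ℝ}
    (cP : Continuous (Function.uncurry P)) (cQ : Continuous (Function.uncurry Q))
    (cPr : Continuous (Function.uncurry Pr)) (cPt : Continuous (Function.uncurry Pt))
    (cQr : Continuous (Function.uncurry Qr)) (cQt : Continuous (Function.uncurry Qt))
    (hPr : ∀ r t, HasDerivAt (fun r => P r t) (Pr r t) r)
    (hPt : ∀ r t, HasDerivAt (fun t => P r t) (Pt r t) t)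
    (hQr : ∀ r t, HasDerivAt (fun r => Q r t) (Qr r t) r)
    (hQt : ∀ r t, HasDerivAt (fun t => Q r t) (Qt r t) t)
    (α β : ℝ) (pP : ∀ r, P r α = P r β) (pQ : ∀ r, Q r α = Q r β) (r : ℝ) :
    HasDerivAt (fun r => ∫ t in α..β, P r t * Qt r t)
      (∫ t in α..β, (Pr r t * Qt r t - Qr r t * Pt r t)) r := by
  have sl : ∀ {F : ℝ → ℝ → ℝ}, Continuous (Function.uncurry F) → ∀ r, Continuous (F r) :=
    fun hF r => hF.comp (f := fun t => (r, t)) (by fun_prop)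
  have hI : Continuous (Function.uncurry fun h t : ℝ =>
      (∫ s in (0:ℝ)..1, Pr (r + s * h) t) * Qt (r + h) t -
      (∫ s in (0:ℝ)..1, Qr (r + s * h) t) * Pt r t) := by
    have h1 := slope_cont cPr r
    have h2 := slope_cont cQr r
    have h3 : Continuous fun p : ℝ × ℝ => Qt (r + p.1) p.2 :=
      cQt.comp (f := fun p : ℝ × ℝ => (r + p.1, p.2)) (by fun_prop)
    have h4 : Continuous fun p : ℝ × ℝ => Pt r p.2 :=
      cPt.comp (f := fun p : ℝ × ℝ => (r, p.2)) (by fun_prop)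
    exact (h1.mul h3).sub (h2.mul h4)
  have hK := intervalIntegral.continuous_parametric_intervalIntegral_of_continuous' (μ := volume)
    hI α β
  have := hasDerivAt_of_eq_mul (S := fun r => ∫ t in α..β, P r t * Qt r t) (r := r) hK (by
    intro h
    -- integrate by parts
    have ibp : (∫ t in α..β, P r t * (Qt (r + h) t - Qt r t)) =
        - ∫ t in α..β, Pt r t * (Q (r + h) t - Q r t) := by
      have := intervalIntegral.integral_mul_deriv_eq_deriv_mul (a := α) (b := β)
        (u := P r) (v := fun t => Q (r + h) t - Q r t) (u' := Pt r)
        (v' := fun t => Qt (r + h) t - Qt r t) (fun t _ => hPt r t)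
        (fun t _ => (hQt _ t).sub (hQt r t))
        ((sl cPt r).intervalIntegrable _ _)
        (((sl cQt _).sub (sl cQt r)).intervalIntegrable _ _)
      rw [this, pP, pQ, pQ]; ring
    have e1 : (∫ t in α..β, P (r + h) t * Qt (r + h) t) - ∫ t in α..β, P r t * Qt r t =
        (∫ t in α..β, (P (r + h) t - P r t) * Qt (r + h) t) +
          ∫ t in α..β, P r t * (Qt (r + h) t - Qt r t) := by
      have a1 := sl cP r
      have a2 := sl cP (r + h)
      have a3 := sl cQt r
      have a4 := sl cQt (r + h)
      rw [← intervalIntegral.integral_sub, ← intervalIntegral.integral_add]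
      · congr 1; ext t; ring
      all_goals exact Continuous.intervalIntegrable (by fun_prop) _ _
    have b1 := sl cP r
    have b2 := sl cP (r + h)
    have b3 := sl cQt (r + h)
    have b4 := sl cQ r
    have b5 := sl cQ (r + h)
    have b6 := sl cPt r
    rw [e1, ibp, ← sub_eq_add_neg, ← intervalIntegral.integral_const_mul,
      ← intervalIntegral.integral_sub]
    · congr 1; ext t
      rw [hadamard_slope cPr hPr, hadamard_slope cQr hQr]; ring
    all_goals exact Continuous.intervalIntegrable (by fun_prop) _ _)
  simpa using this

def gam (r t : ℝ) : E2 := !₂[r * cos t, r * sin t]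

theorem gam_zero (r t : ℝ) : gam r t 0 = r * cos t := by simp [gam]
theorem gam_one (r t : ℝ) : gam r t 1 = r * sin t := by simp [gam]

theorem norm_gam (r t : ℝ) : ‖gam r t‖ = |r| := by
  rw [EuclideanSpace.norm_eq, ← Real.sqrt_sq_eq_abs]
  congr 1
  simp only [Fin.sum_univ_two, gam_zero, gam_one, Real.norm_eq_abs, sq_abs]
  nlinarith [sin_sq_add_cos_sq t]

theorem gam_cont : Continuous (Function.uncurry gam) := by
  unfold gam Function.uncurry
  fun_prop

theorem integral_E2 (F : E2 → ℝ) : ∫ x, F x = ∫ p : ℝ × ℝ, F !₂[p.1, p.2] := by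
  have h1 := (EuclideanSpace.volume_preserving_symm_measurableEquiv_toLp (Fin 2))
  have h2 := (volume_preserving_finTwoArrow ℝ).comp h1
  have e : (⇑MeasurableEquiv.finTwoArrow ∘ ⇑(MeasurableEquiv.toLp 2 (Fin 2 → ℝ)).symm) =
    ⇑((MeasurableEquiv.toLp 2 (Fin 2 → ℝ)).symm.trans (MeasurableEquiv.finTwoArrow (α := ℝ))) := rfl
  rw [e] at h2
  rw [← h2.integral_comp (MeasurableEquiv.measurableEmbedding _)]
  congr 1; ext x; congr 1
  ext i
  fin_cases i <;> rfl

theorem polar_annulus (F : E2 → ℝ) (K : ℝ → ℝ → ℝ) (s t : ℝ) (hs : 0 ≤ s) (hst : s ≤ t)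
    (hK : ContinuousOn (Function.uncurry K) (Set.Icc s t ×ˢ Set.Icc (-π) π))
    (hF : ∀ r θ, s < r → r < t → r * F (gam r θ) = K r θ) :
    ∫ x in ball (0 : E2) t \ ball 0 s, F x = ∫ r in s..t, ∫ θ in (-π)..π, K r θ := by
  have hπ : -π ≤ π := by linarith [pi_pos]
  rw [← integral_indicator (measurableSet_ball.diff measurableSet_ball), integral_E2,
    ← integral_comp_polarCoord_symm]
  have e : ∀ p ∈ polarCoord.target, p.1 • (ball (0 : E2) t \ ball 0 s).indicator F
      !₂[(polarCoord.symm p).1, (polarCoord.symm p).2] =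
      (Set.Ico s t ×ˢ Set.univ).indicator (fun p : ℝ × ℝ => p.1 * F (gam p.1 p.2)) p := by
    rintro ⟨r, θ⟩ hp
    simp only [polarCoord_target, Set.mem_prod, Set.mem_Ioi] at hp
    have : !₂[(polarCoord.symm (r, θ)).1, (polarCoord.symm (r, θ)).2] = gam r θ := by
      simp [gam]
    rw [this]
    simp only [Set.indicator, Set.mem_sdiff, mem_ball_zero_iff, norm_gam, abs_of_pos hp.1,
      Set.mem_prod, Set.mem_Ico, Set.mem_univ, and_true, not_lt, smul_eq_mul, and_comm]
    split_ifs <;> simp_all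
  rw [setIntegral_congr_fun (by exact polarCoord.open_target.measurableSet) e,
    setIntegral_indicator (measurableSet_Ico.prod MeasurableSet.univ)]
  have e2 : (polarCoord.target ∩ Set.Ico s t ×ˢ Set.univ : Set (ℝ × ℝ)) =ᵐ[volume]
      (Set.Ioo s t ×ˢ Set.Ioo (-π) π : Set (ℝ × ℝ)) := by
    have hz : volume ({s} ×ˢ Set.univ : Set (ℝ × ℝ)) = 0 := by
      rw [Measure.volume_eq_prod, Measure.prod_prod]; simp
    have : ∀ᵐ p : ℝ × ℝ, p ∉ ({s} ×ˢ Set.univ : Set (ℝ × ℝ)) := measure_eq_zero_iff_ae_notMem.1 hz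
    refine eventuallyEq_set.2 ?_
    filter_upwards [this] with p hp
    simp only [Set.mem_prod, Set.mem_singleton_iff, Set.mem_univ, and_true] at hp
    simp only [polarCoord_target, Set.mem_inter_iff, Set.mem_prod, Set.mem_Ioi, Set.mem_Ico,
      Set.mem_univ, and_true, Set.mem_Ioo]
    constructor
    · rintro ⟨⟨h1, h2⟩, h3, h4⟩
      exact ⟨⟨lt_of_le_of_ne h3 (Ne.symm hp), h4⟩, h2⟩
    · rintro ⟨⟨h1, h2⟩, h3⟩
      exact ⟨⟨by linarith, h3⟩, h1.le, h2⟩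
  rw [setIntegral_congr_set e2]
  have e3 : ∀ p ∈ (Set.Ioo s t ×ˢ Set.Ioo (-π) π : Set (ℝ × ℝ)),
      p.1 * F (gam p.1 p.2) = Function.uncurry K p := by
    rintro ⟨r, θ⟩ hp
    exact hF r θ hp.1.1 hp.1.2
  rw [setIntegral_congr_fun (measurableSet_Ioo.prod measurableSet_Ioo) e3,
    Measure.volume_eq_prod, setIntegral_prod]
  · simp only [intervalIntegral.integral_of_le hst, intervalIntegral.integral_of_le hπ,
      integral_Ioc_eq_integral_Ioo, Function.uncurry]
  · rw [← Measure.volume_eq_prod]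
    exact (hK.integrableOn_compact (isCompact_Icc.prod isCompact_Icc)).mono_set
      (Set.prod_mono Set.Ioo_subset_Icc_self Set.Ioo_subset_Icc_self)

theorem dist_gam (b s t : ℝ) (hb : 0 ≤ b) : dist (gam b s) (gam b t) = 2 * b * |sin ((s - t) / 2)| := by
  rw [EuclideanSpace.dist_eq]
  rw [show 2 * b * |sin ((s - t) / 2)| = |2 * b * sin ((s - t) / 2)| by
    rw [abs_mul, abs_of_nonneg (by positivity : (0:ℝ) ≤ 2 * b)], ← Real.sqrt_sq_eq_abs]
  congr 1
  simp only [Fin.sum_univ_two, gam_zero, gam_one, Real.dist_eq, sq_abs]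
  have h1 : cos (s - t) = 1 - 2 * sin ((s - t) / 2) ^ 2 := by
    have := cos_two_mul' ((s - t) / 2)
    have h2 := sin_sq_add_cos_sq ((s - t) / 2)
    rw [show 2 * ((s - t) / 2) = s - t by ring] at this
    linarith
  rw [cos_sub] at h1
  have h3 := sin_sq_add_cos_sq s
  have h4 := sin_sq_add_cos_sq t
  linear_combination b ^ 2 * h3 + b ^ 2 * h4 - 2 * b ^ 2 * h1

theorem gam_lip (b : ℝ) (hb : 0 ≤ b) : LipschitzWith b.toNNReal (gam b) := by
  refine LipschitzWith.of_dist_le_mul fun s t => ?_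
  rw [dist_gam b s t hb, Real.coe_toNNReal b hb, Real.dist_eq]
  have := Real.abs_sin_le_abs (x := (s - t) / 2)
  rw [abs_div, abs_two] at this
  nlinarith

theorem gam_injOn (b : ℝ) (hb : 0 < b) : Set.InjOn (gam b) (Set.Ioc (-π) π) := by
  intro s hs t ht h
  have h1 := dist_gam b s t hb.le
  rw [h, dist_self] at h1
  have h2 : sin ((s - t) / 2) = 0 := by
    have : |sin ((s - t) / 2)| = 0 := by
      rcases mul_eq_zero.1 h1.symm with h | h
      · linarith
      · exact h
    simpa using this
  rw [Real.sin_eq_zero_iff_of_lt_of_lt (by linarith [hs.1, hs.2, ht.1, ht.2])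
    (by linarith [hs.1, hs.2, ht.1, ht.2])] at h2
  linarith

theorem piece_le (b k : ℝ) (hk : 0 < k) (I : Set ℝ) (B : Set E2)
    (hI : ∀ s ∈ I, ∀ t ∈ I, k * dist s t ≤ dist (gam b s) (gam b t)) :
    ENNReal.ofReal k * volume (gam b ⁻¹' B ∩ I) ≤ μH[1] (B ∩ gam b '' I) := by
  have inj : Set.InjOn (gam b) I := by
    intro s hs t ht h
    have := hI s hs t ht
    rw [h, dist_self] at this
    exact dist_le_zero.1 (by nlinarith [dist_nonneg (x := s) (y := t)])
  set g := Function.invFunOn (gam b) I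
  have hg : Set.LeftInvOn g (gam b) I := inj.leftInvOn_invFunOn
  have lip : LipschitzOnWith (k⁻¹).toNNReal g (B ∩ gam b '' I) := by
    refine LipschitzOnWith.of_dist_le_mul ?_
    rintro _ ⟨_, s, hs, rfl⟩ _ ⟨_, t, ht, rfl⟩
    rw [hg hs, hg ht, Real.coe_toNNReal _ (by positivity), inv_mul_eq_div, le_div_iff₀ hk, mul_comm]
    exact hI s hs t ht
  have h1 := lip.hausdorffMeasure_image_le (d := 1) zero_le_one
  have h2 : gam b ⁻¹' B ∩ I ⊆ g '' (B ∩ gam b '' I) := by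
    rintro s ⟨h, hs⟩
    exact ⟨gam b s, ⟨h, s, hs, rfl⟩, hg hs⟩
  have h3 : volume (gam b ⁻¹' B ∩ I) ≤ ENNReal.ofReal k⁻¹ * μH[1] (B ∩ gam b '' I) := by
    rw [← hausdorffMeasure_real]
    refine (measure_mono h2).trans (h1.trans ?_)
    simp [ENNReal.ofReal]
  calc _ ≤ ENNReal.ofReal k * (ENNReal.ofReal k⁻¹ * μH[1] (B ∩ gam b '' I)) := by gcongr
    _ = _ := by
      rw [← mul_assoc, ← ENNReal.ofReal_mul hk.le, mul_inv_cancel₀ hk.ne']; simp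

theorem sin_lower (c : ℝ) (hc : c < 1) : ∃ η > 0, ∀ x, |x| ≤ η → c * |x| ≤ |sin x| := by
  have key : ∀ᶠ η in 𝓝[>] (0:ℝ), c < 1 - η ^ 2 / 4 ∧ η ≤ 1 ∧ 0 < η := by
    refine Filter.Eventually.and ?_ (Filter.Eventually.and ?_ self_mem_nhdsWithin)
    · have : Tendsto (fun η : ℝ => 1 - η ^ 2 / 4) (𝓝[>] 0) (𝓝 1) := by
        refine ((Continuous.tendsto' (by fun_prop) 0 1 (by norm_num))).mono_left nhdsWithin_le_nhds
      exact this.eventually (lt_mem_nhds hc)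
    · exact nhdsWithin_le_nhds (eventually_le_nhds zero_lt_one)
  obtain ⟨η, h1, h2, h3⟩ := key.exists
  refine ⟨η, h3, fun x hx => ?_⟩
  rcases eq_or_ne x 0 with rfl | hx0
  · simp
  have hp : 0 < |x| := abs_pos.2 hx0
  have h5 := Real.sin_gt_sub_cube hp
  have h6 : |sin x| ≥ sin |x| := by
    rcases abs_cases x with ⟨h, _⟩ | ⟨h, _⟩ <;> rw [h]
    · exact le_abs_self _
    · rw [sin_neg]; exact neg_le_abs _
  have h7 : |x| ^ 2 ≤ η ^ 2 := by gcongr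
  nlinarith

theorem circle_measure_le (b : ℝ) (hb : 0 < b) :
    ENNReal.ofReal b • Measure.map (gam b) (volume.restrict (Set.Ioc (-π) π)) ≤
      (μH[1] : Measure E2).restrict (sphere 0 b) := by
  have hc : Continuous (gam b) := (gam_lip b hb.le).continuous
  refine Measure.le_iff.2 fun B hB => ?_
  rw [Measure.smul_apply, smul_eq_mul, Measure.map_apply hc.measurable hB,
    Measure.restrict_apply (hc.measurable hB), Measure.restrict_apply hB]
  have main : ∀ c, 0 < c → c < 1 → ENNReal.ofReal (c * b) *
      volume (gam b ⁻¹' B ∩ Set.Ioc (-π) π) ≤ μH[1] (B ∩ sphere 0 b) := by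
    intro c h0 h1
    obtain ⟨η, hη, hs⟩ := sin_lower c h1
    let I : ℤ → Set ℝ := fun n => Set.Ioc (n • (2 * η)) ((n + 1) • (2 * η)) ∩ Set.Ioc (-π) π
    have hIm : ∀ n, MeasurableSet (I n) := fun n => measurableSet_Ioc.inter measurableSet_Ioc
    have hd : Pairwise (Function.onFun Disjoint I) := fun m n hmn =>
      ((Set.pairwise_disjoint_Ioc_zsmul (2 * η)) hmn).mono Set.inter_subset_left Set.inter_subset_left
    have hu : ⋃ n, I n = Set.Ioc (-π) π := by
      rw [← Set.iUnion_inter, iUnion_Ioc_zsmul (by positivity), Set.univ_inter]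
    have e1 : volume (gam b ⁻¹' B ∩ Set.Ioc (-π) π) = ∑' n, volume (gam b ⁻¹' B ∩ I n) := by
      rw [← hu, Set.inter_iUnion, measure_iUnion]
      · exact fun m n hmn => (hd hmn).mono Set.inter_subset_right Set.inter_subset_right
      · exact fun n => (hc.measurable hB).inter (hIm n)
    have e2 : ∑' n, μH[1] (B ∩ gam b '' I n) ≤ μH[1] (B ∩ sphere 0 b) := by
      rw [← measure_iUnion]
      · refine measure_mono (Set.iUnion_subset fun n => Set.inter_subset_inter_right _ ?_)
        rintro _ ⟨t, _, rfl⟩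
        simp [norm_gam, abs_of_pos hb]
      · refine fun m n hmn => Disjoint.mono Set.inter_subset_right Set.inter_subset_right ?_
        rw [Set.disjoint_left]
        rintro _ ⟨s, hs1, rfl⟩ ⟨t, ht1, hst⟩
        have := gam_injOn b hb ht1.2 hs1.2 hst
        subst this
        exact Set.disjoint_left.1 (hd hmn) hs1 ht1
      · exact fun n => hB.inter ((hIm n).image_of_continuousOn_injOn hc.continuousOn
          ((gam_injOn b hb).mono Set.inter_subset_right))
    rw [e1, ← ENNReal.tsum_mul_left]
    refine le_trans (ENNReal.tsum_le_tsum fun n => ?_) e2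
    refine piece_le b (c * b) (by positivity) (I n) B ?_
    intro s hs' t ht'
    have a1 := hs'.1.1
    have a2 := hs'.1.2
    have a3 := ht'.1.1
    have a4 := ht'.1.2
    rw [add_smul, one_smul] at a2 a4
    rw [dist_gam b s t hb.le, Real.dist_eq]
    have := hs ((s - t) / 2) (by rw [abs_le]; constructor <;> linarith)
    rw [abs_div, abs_two] at this
    nlinarith
  have lim : Tendsto (fun c : ℝ => ENNReal.ofReal (c * b) *
      volume (gam b ⁻¹' B ∩ Set.Ioc (-π) π)) (𝓝[<] 1)
      (𝓝 (ENNReal.ofReal b * volume (gam b ⁻¹' B ∩ Set.Ioc (-π) π))) := by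
    refine ENNReal.Tendsto.mul_const ?_ (Or.inl ?_)
    · refine ENNReal.tendsto_ofReal ?_
      exact (Continuous.tendsto' (by fun_prop) 1 b (by simp)).mono_left nhdsWithin_le_nhds
    · simpa using hb
  refine le_of_tendsto lim ?_
  filter_upwards [self_mem_nhdsWithin, nhdsWithin_le_nhds (lt_mem_nhds (zero_lt_one))] with c h1 h0
  exact main c h0 h1

theorem circle_integral_le (b : ℝ) (hb : 0 < b) (h : E2 → ℝ) (h0 : ∀ x, 0 ≤ h x)
    (hh : ContinuousOn h (sphere 0 b)) :
    b * ∫ t in (-π)..π, h (gam b t) ≤ ∫ x in sphere (0 : E2) b, h x ∂μH[1] := by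
  have hπ : -π ≤ π := by linarith [pi_pos]
  have hc : Continuous (gam b) := (gam_lip b hb.le).continuous
  have hfin : (μH[1] : Measure E2) (sphere 0 b) < ⊤ := by
    have hsub : sphere (0 : E2) b ⊆ gam b '' Set.Icc (-π) π := by
      intro x hx
      rw [mem_sphere_zero_iff_norm] at hx
      let z : ℂ := ⟨x 0, x 1⟩
      have hz : ‖z‖ = b := by
        rw [Complex.norm_def, Complex.normSq_apply, ← hx, EuclideanSpace.norm_eq]
        congr 1
        simp [z, Fin.sum_univ_two, sq]
      refine ⟨z.arg, ⟨(Complex.neg_pi_lt_arg z).le, Complex.arg_le_pi z⟩, ?_⟩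
      ext i
      fin_cases i
      · change gam b z.arg 0 = x 0
        rw [gam_zero, ← hz, Complex.norm_mul_cos_arg]
      · change gam b z.arg 1 = x 1
        rw [gam_one, ← hz, Complex.norm_mul_sin_arg]
    refine (measure_mono hsub).trans_lt ?_
    refine ((gam_lip b hb.le).hausdorffMeasure_image_le zero_le_one _).trans_lt ?_
    rw [hausdorffMeasure_real, Real.volume_Icc]
    exact ENNReal.mul_lt_top (by simp) (by simp)
  have hint : IntegrableOn h (sphere 0 b) (μH[1] : Measure E2) := by
    obtain ⟨C, hC⟩ := (isCompact_sphere (0 : E2) b).exists_bound_of_continuousOn hh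
    exact IntegrableOn.of_bound hfin
      (hh.aestronglyMeasurable isClosed_sphere.measurableSet) C
      (ae_restrict_of_forall_mem isClosed_sphere.measurableSet hC)
  have h1 := integral_mono_measure (circle_measure_le b hb) (Eventually.of_forall h0) hint
  rw [integral_smul_measure, ENNReal.toReal_ofReal hb.le, smul_eq_mul] at h1
  rw [intervalIntegral.integral_of_le hπ]
  have h2 : ∫ x, h x ∂(Measure.map (gam b) (volume.restrict (Set.Ioc (-π) π))) =
      ∫ t in Set.Ioc (-π) π, h (gam b t) := by
    refine integral_map hc.measurable.aemeasurable ?_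
    refine (hint.1.mono_ac ?_)
    refine Measure.AbsolutelyContinuous.trans ?_ (circle_measure_le b hb).absolutelyContinuous
    exact Measure.absolutelyContinuous_smul (by simpa using hb)
  rwa [h2] at h1

theorem gam_eq (r t : ℝ) : gam r t = (r * cos t) • e2 0 + (r * sin t) • e2 1 := by
  ext i; fin_cases i <;> simp [gam, e2]

theorem pd_contDiff {m n : WithTop ℕ∞} {u : E2 → ℝ} (hu : ContDiff ℝ n u) (h : m + 1 ≤ n) (j : Fin 2) :
    ContDiff ℝ m (pd j u) :=
  (hu.fderiv_right h).clm_apply contDiff_const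

theorem hasDerivAt_r {f : E2 → ℝ} (hf : Differentiable ℝ f) (r t : ℝ) :
    HasDerivAt (fun r => f (gam r t)) (cos t * pd 0 f (gam r t) + sin t * pd 1 f (gam r t)) r := by
  have h1 : HasDerivAt (fun r => gam r t) (cos t • e2 0 + sin t • e2 1) r := by
    simp only [gam_eq]
    have := (((hasDerivAt_id r).mul_const (cos t)).smul_const (e2 0)).add
      (((hasDerivAt_id r).mul_const (sin t)).smul_const (e2 1))
    simp only [one_mul] at this
    exact this
  have := (hf (gam r t)).hasFDerivAt.comp_hasDerivAt r h1
  simpa [pd, Function.comp_def] using this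

theorem hasDerivAt_t {f : E2 → ℝ} (hf : Differentiable ℝ f) (r t : ℝ) :
    HasDerivAt (fun t => f (gam r t))
      (r * (-sin t) * pd 0 f (gam r t) + r * cos t * pd 1 f (gam r t)) t := by
  have h1 : HasDerivAt (fun t => gam r t) ((r * (-sin t)) • e2 0 + (r * cos t) • e2 1) t := by
    simp only [gam_eq]
    exact (((hasDerivAt_cos t).const_mul r).smul_const (e2 0)).add
      (((hasDerivAt_sin t).const_mul r).smul_const (e2 1))
  have := (hf (gam r t)).hasFDerivAt.comp_hasDerivAt t h1
  simpa [pd, Function.comp_def] using this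

theorem pd_symm {u : E2 → ℝ} (hu : ContDiff ℝ 2 u) (x : E2) (i j : Fin 2) :
    pd i (pd j u) x = pd j (pd i u) x := by
  have hs : IsSymmSndFDerivAt ℝ u x := hu.contDiffAt.isSymmSndFDerivAt (by simp)
  have hd : DifferentiableAt ℝ (fderiv ℝ u) x :=
    ((hu.fderiv_right (m := 1) (by norm_num)).differentiable (by norm_num)) x
  have key : ∀ i j, pd i (pd j u) x = fderiv ℝ (fderiv ℝ u) x (e2 i) (e2 j) := by
    intro i j
    have : HasFDerivAt (pd j u) ((fderiv ℝ (fderiv ℝ u) x).flip (e2 j)) x := by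
      have := hd.hasFDerivAt.clm_apply (hasFDerivAt_const (e2 j) x)
      simp only [ContinuousLinearMap.comp_zero, zero_add] at this
      exact this
    rw [pd, this.fderiv]; rfl
  rw [key, key]; exact hs _ _

/-- radial component of the gradient -/
def rad (u : E2 → ℝ) (r t : ℝ) : ℝ := pd 0 u (gam r t) * cos t + pd 1 u (gam r t) * sin t
/-- tangential component of the gradient -/
def tang (u : E2 → ℝ) (r t : ℝ) : ℝ := -pd 0 u (gam r t) * sin t + pd 1 u (gam r t) * cos t

def radM (u : E2 → ℝ) (r : ℝ) : ℝ := ∫ t in (-π)..π, (rad u r t ^ 2 - tang u r t ^ 2)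
def tangT (u : E2 → ℝ) (r : ℝ) : ℝ := ∫ t in (-π)..π, tang u r t ^ 2
def detI (u : E2 → ℝ) (r : ℝ) : ℝ := ∫ t in (-π)..π, r * (hess u (gam r t)).det

theorem comp_gam_cont {f : E2 → ℝ} (hf : Continuous f) :
    Continuous (Function.uncurry fun r t => f (gam r t)) := hf.comp gam_cont

theorem rad_cont {u : E2 → ℝ} (hu : ContDiff ℝ 2 u) : Continuous (Function.uncurry (rad u)) := by
  have h0 := comp_gam_cont (pd_contDiff (m := 1) hu (by norm_num) 0).continuous
  have h1 := comp_gam_cont (pd_contDiff (m := 1) hu (by norm_num) 1).continuous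
  unfold Function.uncurry at *
  unfold rad
  fun_prop

theorem tang_cont {u : E2 → ℝ} (hu : ContDiff ℝ 2 u) : Continuous (Function.uncurry (tang u)) := by
  have h0 := comp_gam_cont (pd_contDiff (m := 1) hu (by norm_num) 0).continuous
  have h1 := comp_gam_cont (pd_contDiff (m := 1) hu (by norm_num) 1).continuous
  unfold Function.uncurry at *
  unfold tang
  fun_prop

theorem hess_det_cont {u : E2 → ℝ} (hu : ContDiff ℝ 2 u) : Continuous fun x => (hess u x).det := by
  have h : ∀ i j, Continuous (pd i (pd j u)) := fun i j =>
    (pd_contDiff (m := 0) (pd_contDiff (m := 1) hu (by norm_num) j) (by norm_num) i).continuous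
  simp only [hess, Matrix.det_fin_two, Matrix.of_apply]
  exact ((h _ _).mul (h _ _)).sub ((h _ _).mul (h _ _))

theorem slc {F : ℝ → ℝ → ℝ} (hF : Continuous (Function.uncurry F)) (r : ℝ) : Continuous (F r) :=
  hF.comp (f := fun t => (r, t)) (by fun_prop)

theorem radM_cont {u : E2 → ℝ} (hu : ContDiff ℝ 2 u) : Continuous (radM u) :=
  intervalIntegral.continuous_parametric_intervalIntegral_of_continuous'
    (((rad_cont hu).pow 2).sub ((tang_cont hu).pow 2)) _ _

theorem detI_cont {u : E2 → ℝ} (hu : ContDiff ℝ 2 u) : Continuous (detI u) :=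
  intervalIntegral.continuous_parametric_intervalIntegral_of_continuous'
    (f := fun r t => r * (hess u (gam r t)).det)
    (continuous_fst.mul (comp_gam_cont (hess_det_cont hu))) _ _

theorem gam_per (r : ℝ) : gam r (-π) = gam r π := by simp [gam]

theorem scalar_main {u : E2 → ℝ} (hu : ContDiff ℝ 2 u) :
    ∃ S T' : ℝ → ℝ, S 0 = 0 ∧ (∀ r, HasDerivAt S (detI u r) r) ∧ Continuous T' ∧
      (∀ r, HasDerivAt (tangT u) (T' r) r) ∧ ∀ r, S r = 1 / 2 * radM u r - r / 2 * T' r := by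
  have cP := pd_contDiff (m := 1) hu (by norm_num) 0
  have cQ := pd_contDiff (m := 1) hu (by norm_num) 1
  have c : ∀ i j, Continuous (Function.uncurry fun r t => pd i (pd j u) (gam r t)) := fun i j =>
    comp_gam_cont (pd_contDiff (m := 0) (pd_contDiff (m := 1) hu (by norm_num) j) (by norm_num) i).continuous
  have c00 := c 0 0
  have c01 := c 0 1
  have c10 := c 1 0
  have c11 := c 1 1
  have k0 := comp_gam_cont cP.continuous
  have k1 := comp_gam_cont cQ.continuous
  have dP := cP.differentiable (by norm_num)
  have dQ := cQ.differentiable (by norm_num)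
  set P : ℝ → ℝ → ℝ := fun r t => pd 0 u (gam r t) with hPdef
  set Q : ℝ → ℝ → ℝ := fun r t => pd 1 u (gam r t) with hQdef
  let Pr : ℝ → ℝ → ℝ := fun r t => cos t * pd 0 (pd 0 u) (gam r t) + sin t * pd 1 (pd 0 u) (gam r t)
  let Qr : ℝ → ℝ → ℝ := fun r t => cos t * pd 0 (pd 1 u) (gam r t) + sin t * pd 1 (pd 1 u) (gam r t)
  let Pt : ℝ → ℝ → ℝ := fun r t =>
    r * (-sin t) * pd 0 (pd 0 u) (gam r t) + r * cos t * pd 1 (pd 0 u) (gam r t)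
  let Qt : ℝ → ℝ → ℝ := fun r t =>
    r * (-sin t) * pd 0 (pd 1 u) (gam r t) + r * cos t * pd 1 (pd 1 u) (gam r t)
  have cPr : Continuous (Function.uncurry Pr) := by
    unfold Function.uncurry at *; simp only [Pr]; fun_prop
  have cQr : Continuous (Function.uncurry Qr) := by
    unfold Function.uncurry at *; simp only [Qr]; fun_prop
  have cPt : Continuous (Function.uncurry Pt) := by
    unfold Function.uncurry at *; simp only [Pt]; fun_prop
  have cQt : Continuous (Function.uncurry Qt) := by
    unfold Function.uncurry at *; simp only [Qt]; fun_prop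
  have hPr : ∀ r t, HasDerivAt (fun r => P r t) (Pr r t) r := fun r t => hasDerivAt_r dP r t
  have hQr : ∀ r t, HasDerivAt (fun r => Q r t) (Qr r t) r := fun r t => hasDerivAt_r dQ r t
  have hPt : ∀ r t, HasDerivAt (fun t => P r t) (Pt r t) t := fun r t => hasDerivAt_t dP r t
  have hQt : ∀ r t, HasDerivAt (fun t => Q r t) (Qt r t) t := fun r t => hasDerivAt_t dQ r t
  let q' : ℝ → ℝ → ℝ := fun r t => -Pr r t * sin t + Qr r t * cos t
  have cq' : Continuous (Function.uncurry q') := by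
    unfold Function.uncurry at *; simp only [q']; fun_prop
  have hq' : ∀ r t, HasDerivAt (fun r => tang u r t) (q' r t) r := fun r t =>
    ((hPr r t).neg.mul_const _).add ((hQr r t).mul_const _)
  have cqq : Continuous (Function.uncurry fun r t => 2 * tang u r t * q' r t) :=
    (continuous_const.mul (tang_cont hu)).mul cq'
  refine ⟨fun r => ∫ t in (-π)..π, P r t * Qt r t, fun r => ∫ t in (-π)..π, 2 * tang u r t * q' r t,
    ?_, ?_, ?_, ?_, ?_⟩
  · simp [Qt]
  · intro r
    have := hasDerivAt_area k0 k1 cPr cPt cQr cQt hPr hPt hQr hQt (-π) π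
      (fun r => by simp [P, gam_per]) (fun r => by simp [Q, gam_per]) r
    convert this using 1
    unfold detI
    congr 1; ext t
    simp only [hess, Matrix.det_fin_two, Matrix.of_apply, Pr, Qr, Pt, Qt]
    linear_combination (-r * (pd 0 (pd 0 u) (gam r t) * pd 1 (pd 1 u) (gam r t) -
      pd 0 (pd 1 u) (gam r t) * pd 1 (pd 0 u) (gam r t))) * sin_sq_add_cos_sq t
  · exact intervalIntegral.continuous_parametric_intervalIntegral_of_continuous' cqq _ _
  · intro r
    exact hasDerivAt_paramInt (P := fun r t => tang u r t ^ 2) cqq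
      (by have h := tang_cont hu; unfold Function.uncurry at *; fun_prop)
      (fun r t => by simpa using (hq' r t).fun_pow 2) r _ _
  · intro r
    -- total derivative
    let p' : ℝ → ℝ := fun t => (Pt r t * cos t + P r t * (-sin t)) + (Qt r t * sin t + Q r t * cos t)
    let s' : ℝ → ℝ := fun t => ((-Pt r t) * sin t + (-P r t) * cos t) + (Qt r t * cos t + Q r t * (-sin t))
    have hp' : ∀ t, HasDerivAt (rad u r) (p' t) t := fun t =>
      ((hPt r t).mul (hasDerivAt_cos t)).add ((hQt r t).mul (hasDerivAt_sin t))
    have hs' : ∀ t, HasDerivAt (tang u r) (s' t) t := fun t =>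
      ((hPt r t).neg.mul (hasDerivAt_sin t)).add ((hQt r t).mul (hasDerivAt_cos t))
    let W : ℝ → ℝ := fun t => (p' t * tang u r t + rad u r t * s' t) + (Pt r t * Q r t + P r t * Qt r t)
    have hW : ∀ t, HasDerivAt (fun t => rad u r t * tang u r t + P r t * Q r t) (W t) t := fun t =>
      ((hp' t).mul (hs' t)).add ((hPt r t).mul (hQt r t))
    have z1 := slc k0 r
    have z2 := slc k1 r
    have z3 := slc cPt r
    have z4 := slc cQt r
    have z5 := slc (rad_cont hu) r
    have z6 := slc (tang_cont hu) r
    have z7 := slc cq' r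
    have cW : Continuous W := by simp only [W, p', s']; fun_prop
    have iW : ∫ t in (-π)..π, W t = 0 := by
      rw [intervalIntegral.integral_eq_sub_of_hasDerivAt (fun t _ => hW t) (cW.intervalIntegrable _ _)]
      simp [rad, tang, P, Q, gam_per]
    have hpt : ∀ t, P r t * Qt r t = (1 / 2 * (rad u r t ^ 2 - tang u r t ^ 2) -
        r / 2 * (2 * tang u r t * q' r t)) + 1 / 2 * W t := by
      intro t
      have hsy := pd_symm hu (gam r t) 0 1
      have hsc := sin_sq_add_cos_sq t
      simp only [W, p', s', q', rad, tang, Pr, Qr, Pt, Qt, P, Q]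
      rw [hsy]
      generalize pd 0 (pd 0 u) (gam r t) = A
      generalize pd 1 (pd 0 u) (gam r t) = B
      generalize pd 1 (pd 1 u) (gam r t) = C
      generalize pd 0 u (gam r t) = p
      generalize pd 1 u (gam r t) = q
      generalize cos t = c at *
      generalize sin t = s at *
      have : c ^ 2 = 1 - s ^ 2 := by linarith
      grind
    simp only [hpt]
    rw [intervalIntegral.integral_add, intervalIntegral.integral_sub,
      intervalIntegral.integral_const_mul, intervalIntegral.integral_const_mul,
      intervalIntegral.integral_const_mul, iW]
    · simp [radM]
    all_goals exact Continuous.intervalIntegrable (by fun_prop) _ _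

theorem scalar_formula {u : E2 → ℝ} (hu : ContDiff ℝ 2 u) (a b : ℝ) (ha : 0 < a) (hab : a < b) (hb : b < 1) :
    ∫ r in (0:ℝ)..1, Real.log (b / max a (min r b)) * detI u r =
      1 / 2 * (∫ r in a..b, radM u r / r) - 1 / 2 * (tangT u b - tangT u a) := by
  obtain ⟨S, T', S0, hS, cT, hT, hST⟩ := scalar_main hu
  have cS : Continuous S := continuous_iff_continuousAt.2 fun r => (hS r).continuousAt
  have cφ : Continuous fun r : ℝ => Real.log (b / max a (min r b)) := by
    refine Continuous.log (Continuous.div continuous_const (by fun_prop) ?_) ?_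
    · intro r; exact (lt_of_lt_of_le ha (le_max_left _ _)).ne'
    · intro r; exact (div_pos (ha.trans hab) (lt_of_lt_of_le ha (le_max_left _ _))).ne'
  have cI : Continuous fun r => Real.log (b / max a (min r b)) * detI u r := cφ.mul (detI_cont hu)
  rw [← intervalIntegral.integral_add_adjacent_intervals (cI.intervalIntegrable 0 b) (cI.intervalIntegrable b 1),
    ← intervalIntegral.integral_add_adjacent_intervals (cI.intervalIntegrable 0 a) (cI.intervalIntegrable a b)]
  have e3 : ∫ r in b..1, Real.log (b / max a (min r b)) * detI u r = 0 := by
    rw [intervalIntegral.integral_congr (g := fun _ => (0:ℝ))]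
    · simp
    · intro r hr
      rw [Set.uIcc_of_le hb.le] at hr
      simp [min_eq_right hr.1, max_eq_right hab.le, (ha.trans hab).ne']
  have e1 : ∫ r in (0:ℝ)..a, Real.log (b / max a (min r b)) * detI u r = Real.log (b / a) * S a := by
    rw [intervalIntegral.integral_congr (g := fun r => Real.log (b / a) * detI u r)]
    · rw [intervalIntegral.integral_const_mul, intervalIntegral.integral_eq_sub_of_hasDerivAt
        (fun r _ => hS r) ((detI_cont hu).intervalIntegrable _ _), S0, sub_zero]
    · intro r hr
      rw [Set.uIcc_of_le ha.le] at hr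
      simp [min_eq_left (hr.2.trans hab.le), max_eq_left hr.2]
  have pos : ∀ r ∈ Set.uIcc a b, 0 < r := fun r hr => by
    rw [Set.uIcc_of_le hab.le] at hr; linarith [hr.1]
  have cinv : ContinuousOn (fun r : ℝ => r⁻¹) (Set.uIcc a b) :=
    continuousOn_inv₀.mono fun r hr => (pos r hr).ne'
  have e2 : ∫ r in a..b, Real.log (b / max a (min r b)) * detI u r =
      - (Real.log (b / a) * S a) + ∫ r in a..b, r⁻¹ * S r := by
    rw [intervalIntegral.integral_congr (g := fun r => (Real.log b - Real.log r) * detI u r)]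
    · rw [intervalIntegral.integral_mul_deriv_eq_deriv_mul (u' := fun r => -r⁻¹) (v := S)]
      · rw [Real.log_div (ha.trans hab).ne' ha.ne']
        simp only [neg_mul, intervalIntegral.integral_neg]
        ring
      · intro r hr
        exact (Real.hasDerivAt_log (pos r hr).ne').const_sub _
      · exact fun r _ => hS r
      · exact cinv.neg.intervalIntegrable
      · exact (detI_cont hu).intervalIntegrable _ _
    · intro r hr
      have h0 := pos r hr
      rw [Set.uIcc_of_le hab.le] at hr
      simp only [min_eq_left hr.2, max_eq_right hr.1]
      rw [Real.log_div (ha.trans hab).ne' h0.ne']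
  have e4 : ∫ r in a..b, r⁻¹ * S r = 1 / 2 * (∫ r in a..b, radM u r / r) - 1 / 2 * (tangT u b - tangT u a) := by
    rw [← intervalIntegral.integral_eq_sub_of_hasDerivAt (fun r _ => hT r) (cT.intervalIntegrable _ _),
      ← intervalIntegral.integral_const_mul, ← intervalIntegral.integral_const_mul,
      ← intervalIntegral.integral_sub]
    · refine intervalIntegral.integral_congr fun r hr => ?_
      have := (pos r hr).ne'
      simp only [hST]
      field_simp
    · exact (continuousOn_const.mul ((radM_cont hu).continuousOn.div continuousOn_id
        fun r hr => (pos r hr).ne')).intervalIntegrable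
    · exact (continuous_const.mul cT).intervalIntegrable _ _
  rw [e1, e2, e3, e4]; ring

theorem frob_ge (A B D c s : ℝ) (h : s ^ 2 + c ^ 2 = 1) :
    (c ^ 2 * A + 2 * s * c * B + s ^ 2 * D) ^ 2 ≤ A ^ 2 + B ^ 2 + (B ^ 2 + D ^ 2) ∧
    (s ^ 2 * A - 2 * s * c * B + c ^ 2 * D) ^ 2 ≤ A ^ 2 + B ^ 2 + (B ^ 2 + D ^ 2) := by
  have key : A ^ 2 + B ^ 2 + (B ^ 2 + D ^ 2) = (c ^ 2 * A + 2 * s * c * B + s ^ 2 * D) ^ 2 +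
      (s ^ 2 * A - 2 * s * c * B + c ^ 2 * D) ^ 2 +
      2 * (-(s * c) * A + (c ^ 2 - s ^ 2) * B + s * c * D) ^ 2 := by
    have e : A ^ 2 + B ^ 2 + (B ^ 2 + D ^ 2) = (s ^ 2 + c ^ 2) ^ 2 * (A ^ 2 + B ^ 2 + (B ^ 2 + D ^ 2)) := by
      rw [h]; ring
    rw [e]; ring
  constructor <;> nlinarith [sq_nonneg (c ^ 2 * A + 2 * s * c * B + s ^ 2 * D),
    sq_nonneg (s ^ 2 * A - 2 * s * c * B + c ^ 2 * D),
    sq_nonneg (-(s * c) * A + (c ^ 2 - s ^ 2) * B + s * c * D)]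

theorem G_entries (Δ : ℝ) (y : E2 → E3) (x : E2) :
    frob2 (gmet y x - gDelta Δ x) =
      ((∑ i, pd 0 (fun z => y z i) x ^ 2) - 1 + Δ ^ 2 / ‖x‖ ^ 2 * x 1 ^ 2) ^ 2 +
      ((∑ i, pd 0 (fun z => y z i) x * pd 1 (fun z => y z i) x) - Δ ^ 2 / ‖x‖ ^ 2 * (x 0 * x 1)) ^ 2 +
      (((∑ i, pd 0 (fun z => y z i) x * pd 1 (fun z => y z i) x) - Δ ^ 2 / ‖x‖ ^ 2 * (x 0 * x 1)) ^ 2 +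
      ((∑ i, pd 1 (fun z => y z i) x ^ 2) - 1 + Δ ^ 2 / ‖x‖ ^ 2 * x 0 ^ 2) ^ 2) := by
  simp only [frob2, gmet, gDelta, Dmat, Fin.sum_univ_two, Matrix.sub_apply, Matrix.mul_apply,
    Matrix.transpose_apply, Matrix.of_apply, perpVec, Fin.sum_univ_three, Matrix.one_apply]
  simp
  ring

theorem G_bounds (Δ : ℝ) (y : E2 → E3) (r t : ℝ) (hr : 0 < r) :
    |(∑ i, rad (fun z => y z i) r t ^ 2) - 1| ≤ √(frob2 (gmet y (gam r t) - gDelta Δ (gam r t))) ∧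
    |(∑ i, tang (fun z => y z i) r t ^ 2) - (1 - Δ ^ 2)| ≤
      √(frob2 (gmet y (gam r t) - gDelta Δ (gam r t))) := by
  have hsc := sin_sq_add_cos_sq t
  rw [G_entries, norm_gam, abs_of_pos hr, gam_zero, gam_one]
  have e1 : Δ ^ 2 / r ^ 2 * (r * sin t) ^ 2 = Δ ^ 2 * sin t ^ 2 := by field_simp
  have e2 : Δ ^ 2 / r ^ 2 * (r * cos t) ^ 2 = Δ ^ 2 * cos t ^ 2 := by field_simp
  have e3 : Δ ^ 2 / r ^ 2 * (r * cos t * (r * sin t)) = Δ ^ 2 * (sin t * cos t) := by field_simp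
  rw [e1, e2, e3]
  set A := (∑ i, pd 0 (fun z => y z i) (gam r t) ^ 2) with hA
  set B := (∑ i, pd 0 (fun z => y z i) (gam r t) * pd 1 (fun z => y z i) (gam r t)) with hB
  set D := (∑ i, pd 1 (fun z => y z i) (gam r t) ^ 2) with hD
  have h1 : (∑ i, rad (fun z => y z i) r t ^ 2) = cos t ^ 2 * A + 2 * sin t * cos t * B + sin t ^ 2 * D := by
    simp only [hA, hB, hD, rad, Fin.sum_univ_three]; ring
  have h2 : (∑ i, tang (fun z => y z i) r t ^ 2) = sin t ^ 2 * A - 2 * sin t * cos t * B + cos t ^ 2 * D := by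
    simp only [hA, hB, hD, tang, Fin.sum_univ_three]; ring
  have := frob_ge (A - 1 + Δ ^ 2 * sin t ^ 2) (B - Δ ^ 2 * (sin t * cos t))
    (D - 1 + Δ ^ 2 * cos t ^ 2) (cos t) (sin t) hsc
  refine ⟨Real.abs_le_sqrt (le_trans (le_of_eq ?_) this.1), Real.abs_le_sqrt (le_trans (le_of_eq ?_) this.2)⟩
  · rw [h1]; congr 1
    linear_combination hsc
  · rw [h2]; congr 1
    linear_combination hsc - Δ ^ 2 * (sin t ^ 2 + cos t ^ 2 + 1) * hsc

theorem PhiTest_eq (a b : ℝ) (ha : 0 < a) (hab : a < b) (x : E2) :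
    PhiTest a b x = Real.log (b / max a (min ‖x‖ b)) := by
  unfold PhiTest
  split_ifs with h1 h2
  · rw [min_eq_left (h1.trans hab.le), max_eq_left h1]
  · rw [min_eq_left h2, max_eq_right (not_le.1 h1).le]
  · rw [min_eq_right (not_le.1 h2).le, max_eq_right hab.le, div_self (ha.trans hab).ne', Real.log_one]

theorem main_aux (Δ : ℝ) (y : E2 → E3) (hy : ContDiff ℝ 2 y)
    (a b : ℝ) (ha : 0 < a) (hab : a < b) (hb : b < 1) :
    |(∫ x in ball (0 : E2) 1,
          (∑ i : Fin 3, (hess (fun z => y z i) x).det) * PhiTest a b x)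
        - π * Δ ^ 2 * Real.log (b / a)|
      ≤ (∫ x in ball (0 : E2) b \ ball 0 a,
            Real.sqrt (frob2 (gmet y x - gDelta Δ x)) / ‖x‖ ^ 2)
        + (1 / (2 * b)) *
            ∫ x in sphere (0 : E2) b, Real.sqrt (frob2 (gmet y x - gDelta Δ x)) ∂μH[1]
        + (1 / (2 * a)) *
            ∫ x in sphere (0 : E2) a, Real.sqrt (frob2 (gmet y x - gDelta Δ x)) ∂μH[1] := by
  have hπ : -π ≤ π := by linarith [pi_pos]
  have hb0 := ha.trans hab
  have hu : ∀ i, ContDiff ℝ 2 (fun z => y z i) := fun i => contDiff_euclidean.1 hy i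
  have cφ : Continuous fun r : ℝ => Real.log (b / max a (min r b)) := by
    refine Continuous.log (Continuous.div continuous_const (by fun_prop) ?_) ?_
    · intro r; exact (lt_of_lt_of_le ha (le_max_left _ _)).ne'
    · intro r; exact (div_pos (ha.trans hab) (lt_of_lt_of_le ha (le_max_left _ _))).ne'
  -- left-hand side
  have L1 : (∫ x in ball (0 : E2) 1, (∑ i : Fin 3, (hess (fun z => y z i) x).det) * PhiTest a b x) =
      1 / 2 * (∫ r in a..b, (∑ i, radM (fun z => y z i) r) / r) -
      1 / 2 * ((∑ i, tangT (fun z => y z i) b) - ∑ i, tangT (fun z => y z i) a) := by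
    have h0 : ball (0 : E2) 1 = ball (0 : E2) 1 \ ball 0 0 := by simp
    have cdet : ∀ i, Continuous (Function.uncurry fun r t => (hess (fun z => y z i) (gam r t)).det) :=
      fun i => comp_gam_cont (hess_det_cont (hu i))
    rw [h0, polar_annulus _ (fun r t => Real.log (b / max a (min r b)) *
      ∑ i : Fin 3, r * (hess (fun z => y z i) (gam r t)).det) 0 1 le_rfl zero_le_one]
    · have e : ∀ r : ℝ, (∫ t in (-π)..π, Real.log (b / max a (min r b)) *
          ∑ i : Fin 3, r * (hess (fun z => y z i) (gam r t)).det) =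
          ∑ i : Fin 3, Real.log (b / max a (min r b)) * detI (fun z => y z i) r := by
        intro r
        rw [intervalIntegral.integral_const_mul, intervalIntegral.integral_finsetSum, Finset.mul_sum]
        · rfl
        · intro i _
          exact (continuous_const.mul (slc (cdet i) r)).intervalIntegrable _ _
      simp only [e]
      rw [intervalIntegral.integral_finsetSum]
      · simp only [scalar_formula (hu _) a b ha hab hb]
        simp only [Finset.sum_div]
        rw [intervalIntegral.integral_finsetSum]
        · simp only [Fin.sum_univ_three]; ring
        · intro i _
          refine ContinuousOn.intervalIntegrable ?_
          refine (radM_cont (hu i)).continuousOn.div continuousOn_id fun r hr => ?_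
          rw [Set.uIcc_of_le hab.le] at hr
          exact (lt_of_lt_of_le ha hr.1).ne'
      · intro i _
        exact (cφ.mul (detI_cont (hu i))).intervalIntegrable _ _
    · refine Continuous.continuousOn ?_
      have c2 : Continuous fun p : ℝ × ℝ => Real.log (b / max a (min p.1 b)) := cφ.comp continuous_fst
      refine c2.mul (continuous_finsetSum _ fun i _ => continuous_fst.mul (cdet i))
    · intro r t h1 h2
      rw [PhiTest_eq a b ha hab, norm_gam, abs_of_pos h1, ← Finset.mul_sum]
      ring
  set n : E2 → ℝ := fun x => √(frob2 (gmet y x - gDelta Δ x)) with hn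
  have n0 : ∀ x, 0 ≤ n x := fun x => Real.sqrt_nonneg _
  have cn : ContinuousOn n {0}ᶜ := by
    have c : ∀ i j, ContinuousOn (pd j fun z => y z i) {0}ᶜ := fun i j =>
      (pd_contDiff (m := 1) (hu i) (by norm_num) j).continuous.continuousOn
    have cx : ∀ j : Fin 2, ContinuousOn (fun x : E2 => x j) {0}ᶜ := fun j => by fun_prop
    have cD : ContinuousOn (fun x : E2 => Δ ^ 2 / ‖x‖ ^ 2) {0}ᶜ := by
      refine continuousOn_const.div (by fun_prop) ?_
      intro x hx
      exact pow_ne_zero 2 (norm_ne_zero_iff.2 hx)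
    simp only [hn, G_entries, Fin.sum_univ_three]
    have c00 := c 0 0
    have c01 := c 0 1
    have c10 := c 1 0
    have c11 := c 1 1
    have c20 := c 2 0
    have c21 := c 2 1
    have d0 := cx 0
    have d1 := cx 1
    fun_prop
  have cng : Continuous (Function.uncurry fun r t => n (gam (max a r) t)) := by
    refine cn.comp_continuous (f := fun p : ℝ × ℝ => gam (max a p.1) p.2) ?_ ?_
    · exact gam_cont.comp (f := fun p : ℝ × ℝ => (max a p.1, p.2)) (by fun_prop)
    · rintro ⟨r, t⟩
      have : 0 < max a r := lt_of_lt_of_le ha (le_max_left _ _)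
      simp only [Set.mem_compl_iff, Set.mem_singleton_iff]
      rw [← ne_eq, ← norm_ne_zero_iff, norm_gam]
      exact abs_ne_zero.2 this.ne'
  have cK : Continuous (Function.uncurry fun r t => n (gam (max a r) t) / max a r) := by
    refine cng.div (g := fun p : ℝ × ℝ => max a p.1) (by fun_prop) ?_
    intro p
    exact (lt_of_lt_of_le ha (le_max_left _ _)).ne'
  have R1 : (∫ x in ball (0 : E2) b \ ball 0 a, n x / ‖x‖ ^ 2) =
      ∫ r in a..b, ∫ t in (-π)..π, n (gam (max a r) t) / max a r := by
    refine polar_annulus _ _ a b ha.le hab.le cK.continuousOn ?_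
    intro r t h1 h2
    have h0 := ha.trans h1
    simp only [max_eq_right h1.le, norm_gam, abs_of_pos h0]
    field_simp
  have csph : ∀ c, 0 < c → ContinuousOn n (sphere 0 c) := fun c hc => cn.mono fun x hx => by
    rw [mem_sphere_zero_iff_norm] at hx
    simp only [Set.mem_compl_iff, Set.mem_singleton_iff]
    rw [← ne_eq, ← norm_ne_zero_iff, hx]; exact hc.ne'
  have cslice : ∀ r, a ≤ r → Continuous fun t => n (gam r t) := fun r hr => by
    have := slc cng r
    simpa only [max_eq_right hr] using this
  have ct : ∀ i, ∀ r, Continuous (tang (fun z => y z i) r) := fun i r => slc (tang_cont (hu i)) r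
  have cr : ∀ i, ∀ r, Continuous (rad (fun z => y z i) r) := fun i r => slc (rad_cont (hu i)) r
  have B1 : ∀ c, a ≤ c → |(∑ i, tangT (fun z => y z i) c) - 2 * π * (1 - Δ ^ 2)| ≤
      1 / c * ∫ x in sphere (0 : E2) c, n x ∂μH[1] := by
    intro c hac
    have hc := lt_of_lt_of_le ha hac
    have e : (∑ i, tangT (fun z => y z i) c) - 2 * π * (1 - Δ ^ 2) =
        ∫ t in (-π)..π, ((∑ i, tang (fun z => y z i) c t ^ 2) - (1 - Δ ^ 2)) := by
      rw [intervalIntegral.integral_sub, intervalIntegral.integral_finsetSum]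
      · simp only [tangT, intervalIntegral.integral_const, smul_eq_mul]; ring
      · intro i _
        exact ((ct i c).pow 2).intervalIntegrable _ _
      · exact (continuous_finsetSum _ fun i _ => (ct i c).pow 2).intervalIntegrable _ _
      · simp
    rw [e]
    have h1 : |∫ t in (-π)..π, ((∑ i, tang (fun z => y z i) c t ^ 2) - (1 - Δ ^ 2))| ≤
        ∫ t in (-π)..π, n (gam c t) := by
      rw [← Real.norm_eq_abs]
      exact intervalIntegral.norm_integral_le_of_norm_le hπ
        (Eventually.of_forall fun t _ => (G_bounds Δ y c t hc).2)
        ((cslice c hac).intervalIntegrable _ _)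
    have h2 := circle_integral_le c hc n n0 (csph c hc)
    refine h1.trans ?_
    rw [one_div, inv_mul_eq_div, le_div_iff₀ hc, mul_comm]
    exact h2
  have M1 : |1 / 2 * (∫ r in a..b, (∑ i, radM (fun z => y z i) r) / r) - π * Δ ^ 2 * Real.log (b / a)| ≤
      ∫ r in a..b, ∫ t in (-π)..π, n (gam (max a r) t) / max a r := by
    have pos : ∀ r ∈ Set.uIcc a b, 0 < r := fun r hr => by
      rw [Set.uIcc_of_le hab.le] at hr; linarith [hr.1]
    have cinv : ContinuousOn (fun r : ℝ => r⁻¹) (Set.uIcc a b) :=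
      continuousOn_inv₀.mono fun r hr => (pos r hr).ne'
    have e : 1 / 2 * (∫ r in a..b, (∑ i, radM (fun z => y z i) r) / r) - π * Δ ^ 2 * Real.log (b / a) =
        ∫ r in a..b, (1 / 2 * ((∑ i, radM (fun z => y z i) r) / r) - π * Δ ^ 2 * r⁻¹) := by
      rw [intervalIntegral.integral_sub, intervalIntegral.integral_const_mul,
        intervalIntegral.integral_const_mul, integral_inv_of_pos ha hb0]
      · refine ContinuousOn.intervalIntegrable ?_
        exact continuousOn_const.mul ((continuous_finsetSum _ fun i _ =>
          radM_cont (hu i)).continuousOn.div continuousOn_id fun r hr => (pos r hr).ne')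
      · exact (continuousOn_const.mul cinv).intervalIntegrable
    rw [e, ← Real.norm_eq_abs]
    refine intervalIntegral.norm_integral_le_of_norm_le hab.le (Eventually.of_forall fun r hr => ?_)
      ((intervalIntegral.continuous_parametric_intervalIntegral_of_continuous' cK _ _).intervalIntegrable _ _)
    have hr0 := ha.trans hr.1
    have e2 : 1 / 2 * ((∑ i, radM (fun z => y z i) r) / r) - π * Δ ^ 2 * r⁻¹ =
        ∫ t in (-π)..π, (1 / (2 * r)) * (((∑ i, rad (fun z => y z i) r t ^ 2) - 1) -
          ((∑ i, tang (fun z => y z i) r t ^ 2) - (1 - Δ ^ 2))) := by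
      have e3 : ∀ t, ((∑ i, rad (fun z => y z i) r t ^ 2) - 1) -
          ((∑ i, tang (fun z => y z i) r t ^ 2) - (1 - Δ ^ 2)) =
          (∑ i, (rad (fun z => y z i) r t ^ 2 - tang (fun z => y z i) r t ^ 2)) - Δ ^ 2 := by
        intro t; rw [Finset.sum_sub_distrib]; ring
      simp only [e3]
      rw [intervalIntegral.integral_const_mul, intervalIntegral.integral_sub,
        intervalIntegral.integral_finsetSum]
      · simp only [radM, intervalIntegral.integral_const, smul_eq_mul]; field_simp; ring
      · intro i _
        exact (((cr i r).pow 2).sub ((ct i r).pow 2)).intervalIntegrable _ _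
      · exact (continuous_finsetSum _ fun i _ =>
          (((cr i r).pow 2).sub ((ct i r).pow 2))).intervalIntegrable _ _
      · simp
    rw [e2]
    refine intervalIntegral.norm_integral_le_of_norm_le hπ (Eventually.of_forall fun t _ => ?_)
      ((slc cK r).intervalIntegrable _ _)
    simp only [max_eq_right hr.1.le]
    obtain ⟨g1, g2⟩ := G_bounds Δ y r t hr0
    rw [Real.norm_eq_abs, abs_mul, abs_of_pos (by positivity : 0 < 1 / (2 * r))]
    have g3 := (abs_sub ((∑ i, rad (fun z => y z i) r t ^ 2) - 1)
      ((∑ i, tang (fun z => y z i) r t ^ 2) - (1 - Δ ^ 2))).trans (add_le_add g1 g2)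
    calc _ ≤ 1 / (2 * r) * (n (gam r t) + n (gam r t)) := by gcongr
      _ = _ := by field_simp; ring
  have Bb := B1 b hab.le
  have Ba := B1 a le_rfl
  rw [L1, R1]
  have s1 : ∀ c X : ℝ, 1 / (2 * c) * X = 1 / 2 * (1 / c * X) := fun c X => by
    rw [one_div, mul_inv]; ring
  rw [s1, s1]
  rw [abs_le] at *
  constructor <;> linarith [Ba.1, Ba.2, Bb.1, Bb.2, M1.1, M1.2]

/-- testing the Hessian determinant against `Φ_{a,b}`. -/
theorem stmt_10 (Δ : ℝ) (hΔ0 : 0 < Δ) (hΔ1 : Δ < 1) (y : E2 → E3) (hy : ContDiff ℝ 2 y)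
    (a b : ℝ) (ha : 0 < a) (hab : a < b) (hb : b < 1) :
    |(∫ x in ball (0 : E2) 1,
          (∑ i : Fin 3, (hess (fun z => y z i) x).det) * PhiTest a b x)
        - π * Δ ^ 2 * Real.log (b / a)|
      ≤ (∫ x in ball (0 : E2) b \ ball 0 a,
            Real.sqrt (frob2 (gmet y x - gDelta Δ x)) / ‖x‖ ^ 2)
        + (1 / (2 * b)) *
            ∫ x in sphere (0 : E2) b, Real.sqrt (frob2 (gmet y x - gDelta Δ x)) ∂μH[1]
        + (1 / (2 * a)) *
            ∫ x in sphere (0 : E2) a, Real.sqrt (frob2 (gmet y x - gDelta Δ x)) ∂μH[1] := by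
  exact main_aux Δ y hy a b ha hab hb
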